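/- Under the uniform local ℓ_p stability assumption and the stated conditions on α and γ, the value function V is finite at every nonempty compact subset of D̃ and, restricted to the class of nonempty compact subsets of D̃, is continuous with respect to the symmetric Hausdorff distance d_H^s. -/

import Mathlib

open Metric Set Filter Topology TopologicalSpace ENNReal

noncomputable section

abbrev Euc (n : ℕ) : Type := EuclideanSpace ℝ (Fin n)

/-- Trajectory of the discrete-time uncertain system `x_{k+1} = f (x_k) (w_k)`. -/
def traj {n m : ℕ} (f : Euc n → Euc m → Euc n) (x : Euc n) (π : ℕ → Euc m) : ℕ → Euc n
  | 0 => x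
  | k + 1 => f (traj f x π k) (π k)

/-- Reachable set of `X` at time `k` under disturbance signals taking values in `W`. -/
def reach {n m : ℕ} (f : Euc n → Euc m → Euc n) (W : Set (Euc m)) (X : Set (Euc n)) (k : ℕ) :
    Set (Euc n) :=
  {y | ∃ x ∈ X, ∃ π : ℕ → Euc m, (∀ j, π j ∈ W) ∧ y = traj f x π k}

/-- The one-step set-valued map `F(X) = {f x w : x ∈ X, w ∈ W}`. -/
def Fmap {n m : ℕ} (f : Euc n → Euc m → Euc n) (W : Set (Euc m)) (X : Set (Euc n)) :
    Set (Euc n) :=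
  Set.image2 f X W

/-- Asymmetric (directed) Hausdorff distance `sup_{x ∈ A} dist(x, B)`. -/
def dHa {n : ℕ} (A B : Set (Euc n)) : ℝ := ⨆ x : A, Metric.infDist (x : Euc n) B

/-- Uniform local ℓ_p stability of the robust invariant set `𝒜` within the safe set `𝒳`. -/
structure LpStable {n m : ℕ} (f : Euc n → Euc m → Euc n) (W : Set (Euc m))
    (𝒳 𝒜 : Set (Euc n)) where
  r : ℝ
  M : ℝ
  p : ℝ
  lam : ℝ → ℕ → ℝ
  r_pos : 0 < r
  M_ge_one : 1 ≤ M
  p_pos : 0 < p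
  lam_nonneg : ∀ s ∈ Set.Icc (0 : ℝ) r, ∀ k : ℕ, 0 ≤ lam s k
  lam_cont : ∀ k : ℕ, ContinuousOn (fun s => lam s k) (Set.Icc (0 : ℝ) r)
  lam_mono : ∀ k : ℕ, MonotoneOn (fun s => lam s k) (Set.Icc (0 : ℝ) r)
  lam_zero : ∀ k : ℕ, lam 0 k = 0
  lam_anti : ∀ s ∈ Set.Icc (0 : ℝ) r, ∀ k l : ℕ, k ≤ l → lam s l ≤ lam s k
  lam_le_id : ∀ s ∈ Set.Icc (0 : ℝ) r, lam s 0 ≤ s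
  lam_summable : Summable fun k : ℕ => lam r k ^ p
  stab : ∀ x ∈ 𝒳, Metric.infDist x 𝒜 ≤ r →
    ∀ π : ℕ → Euc m, (∀ j, π j ∈ W) →
      ∀ k : ℕ, Metric.infDist (traj f x π k) 𝒜 ≤ M * lam (Metric.infDist x 𝒜) k

/-- The safe robust domain of uniform attraction. -/
def DOUA {n m : ℕ} (f : Euc n → Euc m → Euc n) (W : Set (Euc m)) (𝒳 𝒜 : Set (Euc n)) :
    Set (Euc n) :=
  {x | (∀ k : ℕ, reach f W {x} k ⊆ 𝒳) ∧
    Filter.Tendsto (fun k => dHa (reach f W {x} k) 𝒜) Filter.atTop (nhds 0)}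

/-- The safe robust domain of attraction. -/
def DOA {n m : ℕ} (f : Euc n → Euc m → Euc n) (W : Set (Euc m)) (𝒳 𝒜 : Set (Euc n)) :
    Set (Euc n) :=
  {x | ∀ π : ℕ → Euc m, (∀ j, π j ∈ W) →
    (∀ k : ℕ, traj f x π k ∈ 𝒳) ∧
      Filter.Tendsto (fun k => Metric.infDist (traj f x π k) 𝒜) Filter.atTop (nhds 0)}

/-- `Ψ(X) = (sup_{y∈X} γ y) * (sup_{y∈X} α y)`. -/
def Psi {n : ℕ} (α : Euc n → ℝ) (γ : Euc n → ℝ≥0∞) (X : Set (Euc n)) : ℝ≥0∞ :=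
  (⨆ y : X, γ (y : Euc n)) * ENNReal.ofReal (⨆ y : X, α (y : Euc n))

/-- The value function `V(X) = Σ_k Ψ(R(X,k))`. -/
def Vval {n m : ℕ} (f : Euc n → Euc m → Euc n) (W : Set (Euc m)) (α : Euc n → ℝ)
    (γ : Euc n → ℝ≥0∞) (X : Set (Euc n)) : ℝ≥0∞ :=
  ∑' k : ℕ, Psi α γ (reach f W X k)

/-- `exp(-a)` for `a ∈ [0,∞]`, with `exp(-∞) = 0`. -/
def expNeg (a : ℝ≥0∞) : ℝ := if a = ⊤ then 0 else Real.exp (-a.toReal)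

/-- The value function `W(X) = 1 - exp(-V(X))`. -/
def Wval {n m : ℕ} (f : Euc n → Euc m → Euc n) (W : Set (Euc m)) (α : Euc n → ℝ)
    (γ : Euc n → ℝ≥0∞) (X : Set (Euc n)) : ℝ :=
  1 - expNeg (Vval f W α γ X)

/-- `ξ(X) = 1 - exp(-Ψ(X))`. -/
def xival {n : ℕ} (α : Euc n → ℝ) (γ : Euc n → ℝ≥0∞) (X : Set (Euc n)) : ℝ :=
  1 - expNeg (Psi α γ X)

/-- `β(X) = exp(Ψ(X)) - 1`. -/
def betaval {n : ℕ} (α : Euc n → ℝ) (γ : Euc n → ℝ≥0∞) (X : Set (Euc n)) : ℝ :=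
  Real.exp ((Psi α γ X).toReal) - 1

/-- Conditions on `α`: continuous with `α̲ dist(x,𝒜)^p̄ ≤ α(x) ≤ ᾱ dist(x,𝒜)^p̄`. -/
def AlphaHyp {n : ℕ} (𝒜 : Set (Euc n)) (α : Euc n → ℝ) (αlow αup pbar : ℝ) : Prop :=
  Continuous α ∧ 0 < αlow ∧ αlow ≤ αup ∧
    ∀ x : Euc n, αlow * Metric.infDist x 𝒜 ^ pbar ≤ α x ∧
      α x ≤ αup * Metric.infDist x 𝒜 ^ pbar

/-- Conditions on `γ`: finite, continuous and `≥ γ̲ > 0` on `𝒳`, `= ∞` outside `𝒳`,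
blowing up along sequences converging to the boundary of `𝒳`. -/
def GammaHyp {n : ℕ} (𝒳 : Set (Euc n)) (γ : Euc n → ℝ≥0∞) (γlow : ℝ) : Prop :=
  (∀ x ∈ 𝒳, γ x ≠ ⊤) ∧ ContinuousOn γ 𝒳 ∧ 0 < γlow ∧
    (∀ x ∈ 𝒳, ENNReal.ofReal γlow ≤ γ x) ∧
    (∀ x ∉ 𝒳, γ x = ⊤) ∧
    ∀ (u : ℕ → Euc n) (x : Euc n), x ∈ frontier 𝒳 →
      Filter.Tendsto u Filter.atTop (nhds x) →
      Filter.Tendsto (fun k => γ (u k)) Filter.atTop (nhds ⊤)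

section Helpers

variable {n m : ℕ}

lemma traj_continuous (f : Euc n → Euc m → Euc n)
    (hf : Continuous fun p : Euc n × Euc m => f p.1 p.2) (π : ℕ → Euc m) (k : ℕ) :
    Continuous fun x => traj f x π k := by
  induction k with
  | zero => exact continuous_id
  | succ k ih => exact hf.comp (ih.prodMk continuous_const)

lemma traj_add (f : Euc n → Euc m → Euc n) (x : Euc n) (π : ℕ → Euc m) (k j : ℕ) :
    traj f x π (k + j) = traj f (traj f x π k) (fun i => π (k + i)) j := by
  induction j with
  | zero => rfl
  | succ j ih =>
    change f (traj f x π (k + j)) (π (k + j)) = _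
    rw [ih]; rfl

lemma reach_zero (f : Euc n → Euc m → Euc n) (W : Set (Euc m)) (hW : W.Nonempty)
    (X : Set (Euc n)) : reach f W X 0 = X := by
  ext y
  constructor
  · rintro ⟨x, hx, π, -, rfl⟩; exact hx
  · intro hy
    obtain ⟨w, hw⟩ := hW
    exact ⟨y, hy, fun _ => w, fun _ => hw, rfl⟩

lemma traj_congr (f : Euc n → Euc m → Euc n) (x : Euc n) (π π' : ℕ → Euc m) (k : ℕ)
    (h : ∀ j < k, π j = π' j) : traj f x π k = traj f x π' k := by
  induction k with
  | zero => rfl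
  | succ k ih =>
    change f (traj f x π k) (π k) = f (traj f x π' k) (π' k)
    rw [ih (fun j hj => h j (by omega)), h k (by omega)]

lemma reach_succ (f : Euc n → Euc m → Euc n) (W : Set (Euc m))
    (X : Set (Euc n)) (k : ℕ) : reach f W X (k + 1) = Set.image2 f (reach f W X k) W := by
  ext y
  constructor
  · rintro ⟨x, hx, π, hπ, rfl⟩
    exact ⟨_, ⟨x, hx, π, hπ, rfl⟩, π k, hπ k, rfl⟩
  · rintro ⟨_, ⟨x, hx, π, hπ, rfl⟩, w, hw, rfl⟩
    refine ⟨x, hx, fun j => if j < k then π j else w, fun j => ?_, ?_⟩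
    · dsimp only; split_ifs
      exacts [hπ j, hw]
    · change _ = f (traj f x _ k) _
      rw [traj_congr f x π (fun j => if j < k then π j else w) k (fun j hj => by simp [hj])]
      simp

lemma reach_compact (f : Euc n → Euc m → Euc n)
    (hf : Continuous fun p : Euc n × Euc m => f p.1 p.2) (W : Set (Euc m)) (hW : W.Nonempty)
    (hWc : IsCompact W) (X : Set (Euc n)) (hX : IsCompact X) (k : ℕ) :
    IsCompact (reach f W X k) := by
  induction k with
  | zero => rwa [reach_zero f W hW]
  | succ k ih =>
    rw [reach_succ, ← Set.image_prod]
    exact (ih.prod hWc).image hf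

lemma reach_nonempty (f : Euc n → Euc m → Euc n)
    (W : Set (Euc m)) (hW : W.Nonempty)
    (X : Set (Euc n)) (hX : X.Nonempty) (k : ℕ) :
    (reach f W X k).Nonempty := by
  obtain ⟨x, hx⟩ := hX
  obtain ⟨w, hw⟩ := hW
  exact ⟨_, x, hx, fun _ => w, fun _ => hw, rfl⟩

/-- The set of points all of whose time-`k` successors lie in an open set is open. -/
lemma isOpen_reach (f : Euc n → Euc m → Euc n)
    (hf : Continuous fun p : Euc n × Euc m => f p.1 p.2) (W : Set (Euc m)) (hW : W.Nonempty)
    (hWc : IsCompact W) (k : ℕ) : ∀ O : Set (Euc n), IsOpen O →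
    IsOpen {x | reach f W {x} k ⊆ O} := by
  induction k with
  | zero =>
    intro O hO
    simpa [reach_zero f W hW] using hO
  | succ k ih =>
    intro O hO
    have h1 : IsOpen {y | ∀ w ∈ W, f y w ∈ O} := by
      rw [isOpen_iff_mem_nhds]
      intro y hy
      obtain ⟨U, V, hU, hV, hyU, hWV, hUV⟩ := generalized_tube_lemma
        (isCompact_singleton (x := y)) hWc (hO.preimage hf)
        (by rintro ⟨a, b⟩ ⟨ha, hb⟩; rw [mem_singleton_iff] at ha; subst ha; exact hy b hb)
      filter_upwards [hU.mem_nhds (hyU rfl)] with z hz w hw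
      exact hUV (show (z, w) ∈ U ×ˢ V from ⟨hz, hWV hw⟩)
    convert ih _ h1 using 2
    funext x
    rw [reach_succ, Set.image2_subset_iff]
    rfl

lemma reach_subset_iff (f : Euc n → Euc m → Euc n) (W : Set (Euc m)) (X O : Set (Euc n)) (k : ℕ) :
    reach f W X k ⊆ O ↔ X ⊆ {x | reach f W {x} k ⊆ O} := by
  constructor
  · rintro h x hx _ ⟨x', hx', π, hπ, rfl⟩
    rw [mem_singleton_iff] at hx'; subst hx'
    exact h ⟨x', hx, π, hπ, rfl⟩
  · rintro h _ ⟨x, hx, π, hπ, rfl⟩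
    exact h hx ⟨x, rfl, π, hπ, rfl⟩

lemma sup_tendsto (f : Euc n → Euc m → Euc n)
    (hf : Continuous fun p : Euc n × Euc m => f p.1 p.2) (W : Set (Euc m)) (hW : W.Nonempty)
    (hWc : IsCompact W) (𝒳 : Set (Euc n)) (h𝒳 : IsOpen 𝒳) (g : Euc n → ℝ≥0∞)
    (hg : ContinuousOn g 𝒳) (k : ℕ) (K : NonemptyCompacts (Euc n))
    (hK : reach f W (K : Set (Euc n)) k ⊆ 𝒳) :
    Tendsto (fun L : NonemptyCompacts (Euc n) => ⨆ y : reach f W (L : Set (Euc n)) k, g y)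
      (𝓝 K) (𝓝 (⨆ y : reach f W (K : Set (Euc n)) k, g y)) := by
  rw [tendsto_order]
  constructor
  · intro a ha
    obtain ⟨⟨_, x, hx, π, hπ, rfl⟩, hy⟩ := lt_iSup_iff.1 ha
    have hO : IsOpen (𝒳 ∩ g ⁻¹' Ioi a) := hg.isOpen_inter_preimage h𝒳 isOpen_Ioi
    have hO' := hO.preimage (traj_continuous f hf π k)
    have := (NonemptyCompacts.isOpen_inter_nonempty_of_isOpen hO').mem_nhds
      (x := K) ⟨x, hx, hK ⟨x, hx, π, hπ, rfl⟩, hy⟩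
    filter_upwards [this] with L hL
    obtain ⟨z, hz, -, hz2⟩ := hL
    exact lt_iSup_iff.2 ⟨⟨_, z, hz, π, hπ, rfl⟩, hz2⟩
  · intro b hb
    obtain ⟨c, hc1, hc2⟩ := exists_between hb
    have hO : IsOpen (𝒳 ∩ g ⁻¹' Iio c) := hg.isOpen_inter_preimage h𝒳 isOpen_Iio
    have hO' := isOpen_reach f hf W hW hWc k _ hO
    have := (NonemptyCompacts.isOpen_subsets_of_isOpen hO').mem_nhds
      (x := K) ((reach_subset_iff _ _ _ _ _).1
        (fun y hy => ⟨hK hy, (le_iSup (fun y : reach f W (K : Set (Euc n)) k => g y)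
          ⟨y, hy⟩).trans_lt hc1⟩))
    filter_upwards [this] with L hL
    refine lt_of_le_of_lt (iSup_le ?_) hc2
    rintro ⟨y, hy⟩
    exact (((reach_subset_iff _ _ _ _ _).2 hL) hy).2.le

lemma sup_ne_top (𝒳 : Set (Euc n)) (g : Euc n → ℝ≥0∞) (hg : ContinuousOn g 𝒳)
    (hfin : ∀ x ∈ 𝒳, g x ≠ ⊤) (S : Set (Euc n)) (hS : IsCompact S) (hS𝒳 : S ⊆ 𝒳) :
    (⨆ y : S, g y) ≠ ⊤ := by
  rcases S.eq_empty_or_nonempty with rfl | hne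
  · simp
  · obtain ⟨x, hx, hmax⟩ := hS.exists_isMaxOn hne (hg.mono hS𝒳)
    exact ne_top_of_le_ne_top (hfin x (hS𝒳 hx)) (iSup_le fun y => hmax y.2)

lemma ofReal_sup (α : Euc n → ℝ) (hα : Continuous α) (S : Set (Euc n)) (hS : IsCompact S)
    (hne : S.Nonempty) : ENNReal.ofReal (⨆ y : S, α y) = ⨆ y : S, ENNReal.ofReal (α y) := by
  haveI := hne.to_subtype
  refine Monotone.map_ciSup_of_continuousAt (ENNReal.continuous_ofReal.continuousAt)
    (fun a b h => ENNReal.ofReal_le_ofReal h) ?_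
  have := (hS.image hα).bddAbove
  rwa [image_eq_range] at this

lemma tail_bound (f : Euc n → Euc m → Euc n)
    (hf : Continuous fun p : Euc n × Euc m => f p.1 p.2) (W : Set (Euc m)) (hW : W.Nonempty)
    (hWc : IsCompact W) (𝒳 𝒜 : Set (Euc n)) (h𝒜ne : 𝒜.Nonempty)
    (H : LpStable f W 𝒳 𝒜) (δ : ℝ) (hδ : 0 < δ)
    (hδ𝒳 : ∀ x, infDist x 𝒜 ≤ δ → x ∈ 𝒳)
    (K : Set (Euc n)) (hK : IsCompact K) (hKD : K ⊆ DOUA f W 𝒳 𝒜) :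
    ∃ U, IsOpen U ∧ K ⊆ U ∧ ∃ N : ℕ, ∀ x ∈ U, ∀ π : ℕ → Euc m, (∀ j, π j ∈ W) → ∀ k, N ≤ k →
      infDist (traj f x π k) 𝒜 ≤ δ ∧ infDist (traj f x π k) 𝒜 ≤ H.M * H.lam H.r (k - N) := by
  have hM : 0 < H.M := lt_of_lt_of_le one_pos H.M_ge_one
  have hrr : H.r ∈ Icc (0 : ℝ) H.r := ⟨H.r_pos.le, le_rfl⟩
  refine hK.induction_on (p := fun K => ∃ U, IsOpen U ∧ K ⊆ U ∧ ∃ N : ℕ, ∀ x ∈ U,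
    ∀ π : ℕ → Euc m, (∀ j, π j ∈ W) → ∀ k, N ≤ k →
      infDist (traj f x π k) 𝒜 ≤ δ ∧ infDist (traj f x π k) 𝒜 ≤ H.M * H.lam H.r (k - N))
    ⟨∅, isOpen_empty, subset_rfl, 0, by simp⟩ ?_ ?_ ?_
  · rintro s t hst ⟨U, hU, htU, h⟩
    exact ⟨U, hU, hst.trans htU, h⟩
  · rintro s t ⟨U, hU, hsU, N, h⟩ ⟨U', hU', htU', N', h'⟩
    refine ⟨U ∪ U', hU.union hU', union_subset_union hsU htU', max N N', ?_⟩
    rintro x (hx | hx) π hπ k hk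
    · obtain ⟨h1, h2⟩ := h x hx π hπ k (le_trans (le_max_left _ _) hk)
      refine ⟨h1, h2.trans (mul_le_mul_of_nonneg_left (H.lam_anti _ hrr _ _ ?_) hM.le)⟩
      have := le_max_left N N'
      omega
    · obtain ⟨h1, h2⟩ := h' x hx π hπ k (le_trans (le_max_right _ _) hk)
      refine ⟨h1, h2.trans (mul_le_mul_of_nonneg_left (H.lam_anti _ hrr _ _ ?_) hM.le)⟩
      have := le_max_right N N'
      omega
  · intro x hx
    set ε : ℝ := min (min H.r δ) (δ / H.M) with hε
    have hε0 : 0 < ε := lt_min (lt_min H.r_pos hδ) (div_pos hδ hM)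
    obtain ⟨N, hN⟩ := ((hKD hx).2.eventually (gt_mem_nhds hε0)).exists
    have hO : IsOpen {y : Euc n | infDist y 𝒜 < ε} :=
      isOpen_lt (continuous_infDist_pt 𝒜) continuous_const
    have hO' := isOpen_reach f hf W hW hWc N _ hO
    have hcomp := reach_compact f hf W hW hWc {x} isCompact_singleton N
    have hxU : x ∈ {x | reach f W {x} N ⊆ {y : Euc n | infDist y 𝒜 < ε}} := by
      intro y hy
      refine lt_of_le_of_lt ?_ hN
      refine le_ciSup (f := fun y : reach f W {x} N => infDist (y : Euc n) 𝒜) ?_ ⟨y, hy⟩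
      have := (hcomp.image (continuous_infDist_pt 𝒜)).bddAbove
      rwa [image_eq_range] at this
    refine ⟨_, mem_nhdsWithin_of_mem_nhds (hO'.mem_nhds hxU), _, hO', subset_rfl, N, ?_⟩
    intro z hz π hπ k hk
    obtain ⟨j, rfl⟩ := Nat.exists_eq_add_of_le hk
    rw [traj_add, Nat.add_sub_cancel_left]
    have hlt : infDist (traj f z π N) 𝒜 < ε := hz ⟨z, rfl, π, hπ, rfl⟩
    set y := traj f z π N
    set s := infDist y 𝒜 with hs
    have hs0 : 0 ≤ s := infDist_nonneg
    have hsr : s ≤ H.r := hlt.le.trans ((min_le_left _ _).trans (min_le_left _ _))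
    have hsδ : s ≤ δ := hlt.le.trans ((min_le_left _ _).trans (min_le_right _ _))
    have hsM : s ≤ δ / H.M := hlt.le.trans (min_le_right _ _)
    have hst := H.stab y (hδ𝒳 y hsδ) hsr (fun i => π (N + i)) (fun i => hπ _) j
    refine ⟨hst.trans ?_, hst.trans (mul_le_mul_of_nonneg_left (H.lam_mono j ⟨hs0, hsr⟩ hrr hsr)
      hM.le)⟩
    calc H.M * H.lam s j ≤ H.M * s := mul_le_mul_of_nonneg_left
          ((H.lam_anti s ⟨hs0, hsr⟩ 0 j (Nat.zero_le _)).trans (H.lam_le_id s ⟨hs0, hsr⟩)) hM.le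
      _ ≤ δ := by rw [le_div_iff₀ hM] at hsM; linarith

lemma lam_summable_pbar {f : Euc n → Euc m → Euc n} {W : Set (Euc m)} {𝒳 𝒜 : Set (Euc n)}
    (H : LpStable f W 𝒳 𝒜) (q : ℝ) (hq : H.p ≤ q) :
    Summable fun k : ℕ => H.lam H.r k ^ q := by
  have hrr : H.r ∈ Icc (0 : ℝ) H.r := ⟨H.r_pos.le, le_rfl⟩
  refine Summable.of_nonneg_of_le (fun k => Real.rpow_nonneg (H.lam_nonneg _ hrr k) _)
    (fun k => ?_) (H.lam_summable.mul_right (H.r ^ (q - H.p)))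
  have h0 := H.lam_nonneg _ hrr k
  have h1 : H.lam H.r k ≤ H.r :=
    (H.lam_anti _ hrr 0 k (Nat.zero_le _)).trans (H.lam_le_id _ hrr)
  have hqp : q = H.p + (q - H.p) := by ring
  conv_lhs => rw [hqp, Real.rpow_add_of_nonneg h0 H.p_pos.le (by linarith)]
  exact mul_le_mul_of_nonneg_left (Real.rpow_le_rpow h0 h1 (by linarith))
    (Real.rpow_nonneg h0 _)

lemma Psi_tendsto (f : Euc n → Euc m → Euc n)
    (hf : Continuous fun p : Euc n × Euc m => f p.1 p.2) (W : Set (Euc m)) (hW : W.Nonempty)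
    (hWc : IsCompact W) (𝒳 : Set (Euc n)) (h𝒳 : IsOpen 𝒳) (α : Euc n → ℝ) (hα : Continuous α)
    (γ : Euc n → ℝ≥0∞) (hγ : ContinuousOn γ 𝒳) (hγfin : ∀ x ∈ 𝒳, γ x ≠ ⊤)
    (k : ℕ) (K : NonemptyCompacts (Euc n)) (hK : reach f W (K : Set (Euc n)) k ⊆ 𝒳) :
    Psi α γ (reach f W (K : Set (Euc n)) k) ≠ ⊤ ∧
    Tendsto (fun L : NonemptyCompacts (Euc n) => Psi α γ (reach f W (L : Set (Euc n)) k))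
      (𝓝 K) (𝓝 (Psi α γ (reach f W (K : Set (Euc n)) k))) := by
  have hc : ∀ L : NonemptyCompacts (Euc n), IsCompact (reach f W (L : Set (Euc n)) k) :=
    fun L => reach_compact f hf W hW hWc _ L.isCompact k
  have hn : ∀ L : NonemptyCompacts (Euc n), (reach f W (L : Set (Euc n)) k).Nonempty :=
    fun L => reach_nonempty f W hW _ L.nonempty k
  have hγt := sup_ne_top 𝒳 γ hγ hγfin _ (hc K) hK
  refine ⟨ENNReal.mul_ne_top hγt ENNReal.ofReal_ne_top, ?_⟩
  unfold Psi
  refine ENNReal.Tendsto.mul (sup_tendsto f hf W hW hWc 𝒳 h𝒳 γ hγ k K hK)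
    (Or.inr ENNReal.ofReal_ne_top) ?_ (Or.inr hγt)
  simp_rw [fun L => ofReal_sup α hα _ (hc L) (hn L)]
  exact sup_tendsto f hf W hW hWc univ isOpen_univ (fun y => ENNReal.ofReal (α y))
    (ENNReal.continuous_ofReal.comp hα).continuousOn k K (subset_univ _)

lemma main_bound
    (f : Euc n → Euc m → Euc n) (hf : Continuous fun p : Euc n × Euc m => f p.1 p.2)
    (Wd : Set (Euc m)) (hWne : Wd.Nonempty) (hWc : IsCompact Wd)
    (𝒳 : Set (Euc n)) (h𝒳 : IsOpen 𝒳)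
    (𝒜 : Set (Euc n)) (h𝒜ne : 𝒜.Nonempty) (h𝒜c : IsCompact 𝒜) (h𝒜𝒳 : 𝒜 ⊆ 𝒳)
    (H : LpStable f Wd 𝒳 𝒜)
    (α : Euc n → ℝ) (αlow αup pbar : ℝ) (hα : AlphaHyp 𝒜 α αlow αup pbar)
    (hpbar : H.p ≤ pbar)
    (γ : Euc n → ℝ≥0∞) (γlow : ℝ) (hγ : GammaHyp 𝒳 γ γlow)
    (K : NonemptyCompacts (Euc n)) (hK : (K : Set (Euc n)) ⊆ DOUA f Wd 𝒳 𝒜) :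
    ∃ b : ℕ → ℝ≥0∞, (∑' k, b k) ≠ ⊤ ∧
      ∀ᶠ L : NonemptyCompacts (Euc n) in 𝓝 K, ∀ k, Psi α γ (reach f Wd (L : Set (Euc n)) k) ≤ b k := by
  obtain ⟨hαc, hαl, hαlu, hαb⟩ := hα
  obtain ⟨hγfin, hγc, -⟩ := hγ
  have hM : 0 < H.M := lt_of_lt_of_le one_pos H.M_ge_one
  have hrr : H.r ∈ Icc (0 : ℝ) H.r := ⟨H.r_pos.le, le_rfl⟩
  have hαu : 0 ≤ αup := hαl.le.trans hαlu
  have hq : 0 ≤ pbar := H.p_pos.le.trans hpbar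
  obtain ⟨δ, hδ, hδ𝒳⟩ := h𝒜c.exists_cthickening_subset_open h𝒳 h𝒜𝒳
  have hmem : ∀ x, infDist x 𝒜 ≤ δ → x ∈ cthickening δ 𝒜 := by
    intro x hx
    rw [mem_cthickening_iff, ← ENNReal.ofReal_toReal (infEDist_ne_top h𝒜ne)]
    exact ENNReal.ofReal_le_ofReal hx
  obtain ⟨U, hU, hKU, N, hN⟩ := tail_bound f hf Wd hWne hWc 𝒳 𝒜 h𝒜ne H δ hδ
    (fun x hx => hδ𝒳 (hmem x hx)) K K.isCompact hK
  set G : ℝ≥0∞ := ⨆ y : cthickening δ 𝒜, γ y with hG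
  have hGt : G ≠ ⊤ := sup_ne_top 𝒳 γ hγc hγfin _ h𝒜c.cthickening hδ𝒳
  have hreach : ∀ k, reach f Wd (K : Set (Euc n)) k ⊆ 𝒳 := fun k =>
    (reach_subset_iff _ _ _ _ _).2 (fun x hx => (hK hx).1 k)
  have hP := fun k => Psi_tendsto f hf Wd hWne hWc 𝒳 h𝒳 α hαc γ hγc hγfin k K (hreach k)
  let c : ℕ → ℝ := fun j => αup * (H.M ^ pbar * H.lam H.r j ^ pbar)
  have hc0 : ∀ j, 0 ≤ c j := fun j => mul_nonneg hαu (mul_nonneg (Real.rpow_nonneg hM.le _)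
    (Real.rpow_nonneg (H.lam_nonneg _ hrr j) _))
  have hcs : Summable c := ((lam_summable_pbar H pbar hpbar).mul_left _).mul_left _
  refine ⟨fun k => if k < N then Psi α γ (reach f Wd (K : Set (Euc n)) k) + 1
    else G * ENNReal.ofReal (c (k - N)), ?_, ?_⟩
  · rw [← ENNReal.summable.sum_add_tsum_nat_add' (k := N)]
    refine ENNReal.add_ne_top.2 ⟨?_, ?_⟩
    · refine ENNReal.sum_ne_top.2 fun i hi => ?_
      rw [if_pos (Finset.mem_range.1 hi)]
      exact ENNReal.add_ne_top.2 ⟨(hP i).1, ENNReal.one_ne_top⟩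
    · simp only [Nat.not_lt.2 (Nat.le_add_left N _), if_false, Nat.add_sub_cancel]
      rw [ENNReal.tsum_mul_left, ← ENNReal.ofReal_tsum_of_nonneg hc0 hcs]
      exact ENNReal.mul_ne_top hGt ENNReal.ofReal_ne_top
  · have h1 : ∀ᶠ L : NonemptyCompacts (Euc n) in 𝓝 K, ∀ k ∈ Finset.range N,
        Psi α γ (reach f Wd (L : Set (Euc n)) k) < Psi α γ (reach f Wd (K : Set (Euc n)) k) + 1 := by
      rw [Filter.eventually_all_finset]
      intro k _
      exact (hP k).2.eventually (gt_mem_nhds (ENNReal.lt_add_right (hP k).1 one_ne_zero))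
    filter_upwards [h1, (NonemptyCompacts.isOpen_subsets_of_isOpen hU).mem_nhds (x := K) hKU]
      with L hL hLU k
    by_cases hk : k < N
    · rw [if_pos hk]; exact (hL k (Finset.mem_range.2 hk)).le
    · rw [if_neg hk]
      haveI := (reach_nonempty f Wd hWne _ L.nonempty k).to_subtype
      unfold Psi
      refine mul_le_mul' (iSup_le ?_) (ENNReal.ofReal_le_ofReal (ciSup_le ?_))
      · rintro ⟨_, x, hx, π, hπ, rfl⟩
        exact le_iSup (fun y : cthickening δ 𝒜 => γ y)
          ⟨_, hmem _ (hN x (hLU hx) π hπ k (not_lt.1 hk)).1⟩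
      · rintro ⟨_, x, hx, π, hπ, rfl⟩
        refine (hαb _).2.trans (mul_le_mul_of_nonneg_left ?_ hαu)
        rw [← Real.mul_rpow hM.le (H.lam_nonneg _ hrr _)]
        exact Real.rpow_le_rpow infDist_nonneg (hN x (hLU hx) π hπ k (not_lt.1 hk)).2 hq

end Helpers

theorem stmt10 {n m : ℕ}
    (f : Euc n → Euc m → Euc n) (hf : Continuous fun p : Euc n × Euc m => f p.1 p.2)
    (Wd : Set (Euc m)) (hWne : Wd.Nonempty) (hWc : IsCompact Wd)
    (𝒳 : Set (Euc n)) (h𝒳 : IsOpen 𝒳)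
    (𝒜 : Set (Euc n)) (h𝒜ne : 𝒜.Nonempty) (h𝒜c : IsCompact 𝒜) (h𝒜𝒳 : 𝒜 ⊆ 𝒳)
    (h𝒜inv : ∀ x ∈ 𝒜, ∀ w ∈ Wd, f x w ∈ 𝒜)
    (H : LpStable f Wd 𝒳 𝒜)
    (α : Euc n → ℝ) (αlow αup pbar : ℝ) (hα : AlphaHyp 𝒜 α αlow αup pbar)
    (hpbar : H.p ≤ pbar)
    (γ : Euc n → ℝ≥0∞) (γlow : ℝ) (hγ : GammaHyp 𝒳 γ γlow)
    : (∀ K : NonemptyCompacts (Euc n), (K : Set (Euc n)) ⊆ DOUA f Wd 𝒳 𝒜 →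
        Vval f Wd α γ (K : Set (Euc n)) ≠ ⊤) ∧
      ContinuousOn (fun K : NonemptyCompacts (Euc n) => Vval f Wd α γ (K : Set (Euc n)))
        {K : NonemptyCompacts (Euc n) | (K : Set (Euc n)) ⊆ DOUA f Wd 𝒳 𝒜} := by
  have hb := main_bound f hf Wd hWne hWc 𝒳 h𝒳 𝒜 h𝒜ne h𝒜c h𝒜𝒳 H α αlow αup pbar hα hpbar γ γlow hγ
  constructor
  · intro K hK
    obtain ⟨b, hb1, hb2⟩ := hb K hK
    exact ne_top_of_le_ne_top hb1 (ENNReal.tsum_le_tsum hb2.self_of_nhds)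
  · intro K hK
    obtain ⟨b, hb1, hb2⟩ := hb K hK
    refine Tendsto.mono_left ?_ nhdsWithin_le_nhds
    have hreach : ∀ k, reach f Wd (K : Set (Euc n)) k ⊆ 𝒳 := fun k =>
      (reach_subset_iff _ _ _ _ _).2 (fun x hx => (hK hx).1 k)
    unfold Vval
    simp_rw [← MeasureTheory.lintegral_count]
    refine MeasureTheory.tendsto_lintegral_filter_of_dominated_convergence b
      (Eventually.of_forall fun L => measurable_of_countable _) ?_ ?_ ?_
    · filter_upwards [hb2] with L hL
      exact Eventually.of_forall hL
    · rwa [MeasureTheory.lintegral_count]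
    · exact Eventually.of_forall fun k => (Psi_tendsto f hf Wd hWne hWc 𝒳 h𝒳 α hα.1 γ hγ.2.1 hγ.1
        k K (hreach k)).2

end
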